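/- Let k ≥ 3 be odd. Let A_{I₂(k)} be the Artin group of type I₂(k), presented by generators s₁, s₂ with the relation s₁s₂s₁s₂⋯ = s₂s₁s₂s₁⋯ (alternating products with k factors on each side), let W_{I₂(k)} be the dihedral group of order 2k, and let π_S : A_{I₂(k)} → W_{I₂(k)} be the canonical surjection. Then there exist a group homomorphism f : A_{I₂(k)} → B_k with f(s₁) = σ₂σ₄⋯σ_{k−1} and f(s₂) = σ₁σ₃⋯σ_{k−2}, and an injective homomorphism e : W_{I₂(k)} → S_k with e(s₁) = (2 3)(4 5)⋯(k−1, k) and e(s₂) = (1 2)(3 4)⋯(k−2, k−1), such that π_k ∘ f = e ∘ π_S. -/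

import Mathlib

/-!
Braid group infrastructure.

`BraidGroup m` is the Artin braid group on `m` strands, presented with generators
`σ 0, …, σ (m-2)` (here `σ i` denotes the usual generator `σ_{i+1}`) and the braid
relations `σ i * σ j = σ j * σ i` for `|i - j| ≥ 2` and
`σ i * σ j * σ i = σ j * σ i * σ j` for `j = i + 1`.
-/

/-- The braid relations on `m` strands (generators indexed by `Fin (m - 1)`). -/
def braidRels (m : ℕ) : Set (FreeGroup (Fin (m - 1))) :=
  { r | (∃ i j : Fin (m - 1), (i : ℕ) + 2 ≤ (j : ℕ) ∧
          r = FreeGroup.of i * FreeGroup.of j * (FreeGroup.of i)⁻¹ * (FreeGroup.of j)⁻¹) ∨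
        (∃ i j : Fin (m - 1), (j : ℕ) = (i : ℕ) + 1 ∧
          r = FreeGroup.of i * FreeGroup.of j * FreeGroup.of i *
              (FreeGroup.of j * FreeGroup.of i * FreeGroup.of j)⁻¹) }

/-- The braid group on `m` strands. -/
abbrev BraidGroup (m : ℕ) : Type := PresentedGroup (braidRels m)

/-- The braid generator `σ_{i+1}` of the braid group on `m` strands. -/
def σ {m : ℕ} (i : Fin (m - 1)) : BraidGroup m := PresentedGroup.of i

private lemma swap_commute {α : Type*} [DecidableEq α] {a b c d : α}
    (hac : a ≠ c) (had : a ≠ d) (hbc : b ≠ c) (hbd : b ≠ d) :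
    Equiv.swap a b * Equiv.swap c d = Equiv.swap c d * Equiv.swap a b := by
  have h := (Equiv.swap_apply_apply (Equiv.swap a b) c d).symm
  rw [Equiv.swap_apply_of_ne_of_ne hac.symm hbc.symm,
    Equiv.swap_apply_of_ne_of_ne had.symm hbd.symm] at h
  exact mul_inv_eq_iff_eq_mul.mp h

private lemma swap_braid {α : Type*} [DecidableEq α] {x y z : α}
    (hxy : x ≠ y) (hyz : y ≠ z) (hxz : x ≠ z) :
    Equiv.swap x y * Equiv.swap y z * Equiv.swap x y =
      Equiv.swap y z * Equiv.swap x y * Equiv.swap y z := by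
  have h1 := (Equiv.swap_apply_apply (Equiv.swap x y) y z).symm
  rw [Equiv.swap_apply_right, Equiv.swap_apply_of_ne_of_ne hxz.symm hyz.symm] at h1
  have h2 := (Equiv.swap_apply_apply (Equiv.swap y z) x y).symm
  rw [Equiv.swap_apply_of_ne_of_ne hxy hxz, Equiv.swap_apply_left] at h2
  rw [Equiv.swap_inv] at h1 h2
  calc Equiv.swap x y * Equiv.swap y z * Equiv.swap x y = Equiv.swap x z := h1
    _ = Equiv.swap y z * Equiv.swap x y * Equiv.swap y z := h2.symm

/-- The transposition `(i+1, i+2)`, as image of the braid generator `σ_{i+1}`. -/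
def braidGen (m : ℕ) (i : Fin (m - 1)) : Equiv.Perm (Fin m) :=
  Equiv.swap ⟨i.1, by have := i.isLt; omega⟩ ⟨i.1 + 1, by have := i.isLt; omega⟩

private lemma braid_rels_hold (m : ℕ) :
    ∀ r ∈ braidRels m, FreeGroup.lift (braidGen m) r = 1 := by
  rintro r (⟨i, j, hij, rfl⟩ | ⟨i, j, hij, rfl⟩) <;>
    simp only [map_mul, map_inv, FreeGroup.lift_apply_of]
  · rw [mul_inv_eq_one (a := _ * _ * _), mul_inv_eq_iff_eq_mul]
    unfold braidGen
    apply swap_commute <;> (simp only [ne_eq, Fin.mk.injEq]; omega)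
  · obtain ⟨jv, hjlt⟩ := j
    simp only [Fin.val_mk] at hij
    subst hij
    rw [mul_inv_eq_one (a := _ * _ * _)]
    unfold braidGen
    simp only [Fin.val_mk]
    apply swap_braid <;> (simp only [ne_eq, Fin.mk.injEq]; omega)

/-- The canonical surjection from the braid group on `m` strands to the symmetric
group on `m` letters, sending `σ_{i+1}` to the transposition `(i+1, i+2)`
(`0`-indexed: the swap of `i` and `i + 1` in `Fin m`). -/
def braidToPerm (m : ℕ) : BraidGroup m →* Equiv.Perm (Fin m) :=
  PresentedGroup.toGroup (braid_rels_hold m)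
/-- `altProd x y n` is the alternating product `x * y * x * y * ⋯` with `n` factors. -/
def altProd {G : Type*} [Monoid G] (x y : G) : ℕ → G
  | 0 => 1
  | n + 1 => x * altProd y x n

lemma altProd_add_two {G : Type*} [Monoid G] (x y : G) (n : ℕ) :
    altProd x y (n + 2) = x * y * altProd x y n := by
  simp [altProd, mul_assoc]

lemma altProd_two_mul {G : Type*} [Monoid G] (x y : G) (n : ℕ) :
    altProd x y (2 * n) = (x * y) ^ n := by
  induction n with
  | zero => simp [altProd]
  | succ m ih =>
    rw [show 2 * (m + 1) = 2 * m + 2 from by ring, altProd_add_two, ih, ← pow_succ']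

lemma altProd_two_mul_add_one {G : Type*} [Monoid G] (x y : G) (n : ℕ) :
    altProd x y (2 * n + 1) = (x * y) ^ n * x := by
  induction n with
  | zero => simp [altProd]
  | succ m ih =>
    rw [show 2 * (m + 1) + 1 = (2 * m + 1) + 2 from by ring, altProd_add_two, ih,
      ← mul_assoc, ← pow_succ']

/-- In a group, if `s` and `t` are involutions and `(s * t) ^ k = 1`, then the two
alternating products of `s` and `t` with `k` factors agree. -/
lemma altProd_swap_eq {G : Type*} [Group G] {s t : G} (hs : s * s = 1) (ht : t * t = 1)
    {k : ℕ} (h : (s * t) ^ k = 1) : altProd s t k = altProd t s k := by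
  have hs' : s⁻¹ = s := inv_eq_of_mul_eq_one_right hs
  have ht' : t⁻¹ = t := inv_eq_of_mul_eq_one_right ht
  have hts : t * s = (s * t)⁻¹ := by rw [mul_inv_rev, hs', ht']
  rcases Nat.even_or_odd k with ⟨m, hm⟩ | ⟨m, hm⟩
  · obtain rfl : k = 2 * m := by omega
    rw [altProd_two_mul, altProd_two_mul, hts, inv_pow]
    rw [show 2 * m = m + m from by ring, pow_add] at h
    exact (inv_eq_of_mul_eq_one_right h).symm
  · obtain rfl : k = 2 * m + 1 := by omega
    rw [altProd_two_mul_add_one, altProd_two_mul_add_one, hts, inv_pow]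
    rw [show 2 * m + 1 = m + (m + 1) from by ring, pow_add, pow_succ] at h
    rw [inv_eq_of_mul_eq_one_right h, mul_assoc, mul_assoc, ht, mul_one]

lemma map_altProd {G H : Type*} [Monoid G] [Monoid H] (φ : G →* H) (x y : G) (n : ℕ) :
    φ (altProd x y n) = altProd (φ x) (φ y) n := by
  induction n generalizing x y with
  | zero => simp [altProd]
  | succ m ih => simp [altProd, ih]
/-- The defining (Artin/braid) relation of the Artin group of type `I₂(k)`:
the two alternating products of the generators with `k` factors agree. -/
def I2Rels (k : ℕ) : Set (FreeGroup (Fin 2)) :=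
  { altProd (FreeGroup.of 0) (FreeGroup.of 1) k *
      (altProd (FreeGroup.of 1) (FreeGroup.of 0) k)⁻¹ }

/-- The Artin (generalized braid) group of type `I₂(k)`. -/
abbrev ArtinI2 (k : ℕ) : Type := PresentedGroup (I2Rels k)

/-- The first generator `s₁` of the Artin group of type `I₂(k)`. -/
def I2s₁ {k : ℕ} : ArtinI2 k := PresentedGroup.of 0

/-- The second generator `s₂` of the Artin group of type `I₂(k)`. -/
def I2s₂ {k : ℕ} : ArtinI2 k := PresentedGroup.of 1

/-- The canonical surjection from the Artin group of type `I₂(k)` onto the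
associated Coxeter group, the dihedral group of order `2k` (adding the relations
`s₁² = s₂² = 1`); it sends `s₁ ↦ sr 0` and `s₂ ↦ sr 1`. -/
def artinI2ToDihedral (k : ℕ) : ArtinI2 k →* DihedralGroup k :=
  PresentedGroup.toGroup (f := ![DihedralGroup.sr 0, DihedralGroup.sr 1])
    (by
      intro r hr
      simp only [I2Rels, Set.mem_singleton_iff] at hr
      subst hr
      rw [map_mul, map_inv, mul_inv_eq_one, map_altProd, map_altProd,
        FreeGroup.lift_apply_of, FreeGroup.lift_apply_of]
      simp only [Matrix.cons_val_zero, Matrix.cons_val_one, Matrix.head_cons]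
      refine altProd_swap_eq (DihedralGroup.sr_mul_self 0) (DihedralGroup.sr_mul_self 1) ?_
      rw [DihedralGroup.sr_mul_sr, sub_zero, DihedralGroup.r_one_pow_n])

/-- The ordered product `f 0 * f 1 * ⋯ * f (n - 1)`. -/
def rangeProd {G : Type*} [Monoid G] (f : ℕ → G) : ℕ → G
  | 0 => 1
  | n + 1 => rangeProd f n * f n

section RangeProd

variable {G : Type*} [Monoid G]

lemma rangeProd_succ_left (f : ℕ → G) (n : ℕ) :
    rangeProd f (n + 1) = f 0 * rangeProd (fun i => f (i + 1)) n := by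
  induction n with
  | zero => simp [rangeProd]
  | succ n ih => rw [rangeProd, ih, rangeProd, mul_assoc]

lemma rangeProd_add (f : ℕ → G) (a b : ℕ) :
    rangeProd f (a + b) = rangeProd f a * rangeProd (fun i => f (a + i)) b := by
  induction b with
  | zero => simp [rangeProd]
  | succ b ih => rw [← add_assoc, rangeProd, ih, rangeProd, mul_assoc]

lemma rangeProd_congr {f g : ℕ → G} {n : ℕ} (h : ∀ i < n, f i = g i) :
    rangeProd f n = rangeProd g n := by
  induction n with
  | zero => rfl
  | succ n ih => rw [rangeProd, rangeProd, ih fun i hi => h i (by omega), h n (by omega)]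

lemma rangeProd_one (n : ℕ) : rangeProd (fun _ => (1 : G)) n = 1 := by
  induction n with
  | zero => rfl
  | succ n ih => rw [rangeProd, ih, one_mul]

lemma map_rangeProd {H : Type*} [Monoid H] (φ : G →* H) (f : ℕ → G) (n : ℕ) :
    φ (rangeProd f n) = rangeProd (fun i => φ (f i)) n := by
  induction n with
  | zero => simp [rangeProd]
  | succ n ih => simp [rangeProd, ih]

lemma commute_rangeProd {x : G} {f : ℕ → G} {n : ℕ} (h : ∀ i < n, Commute x (f i)) :
    Commute x (rangeProd f n) := by
  induction n with
  | zero => exact Commute.one_right x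
  | succ n ih => exact (ih fun i hi => h i (by omega)).mul_right (h n (by omega))

lemma rangeProd_semiconj {x : G} {f g : ℕ → G} {n : ℕ} (h : ∀ i < n, SemiconjBy x (f i) (g i)) :
    SemiconjBy x (rangeProd f n) (rangeProd g n) := by
  induction n with
  | zero => exact SemiconjBy.one_right x
  | succ n ih => exact (ih fun i hi => h i (by omega)).mul_right (h n (by omega))

lemma rangeProd_sq {f : ℕ → G} {n : ℕ} (hc : ∀ i j, i < j → Commute (f i) (f j))
    (h : ∀ i < n, f i ^ 2 = 1) : rangeProd f n ^ 2 = 1 := by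
  induction n with
  | zero => simp [rangeProd]
  | succ n ih =>
    have : Commute (rangeProd f n) (f n) :=
      (commute_rangeProd fun i hi => (hc i n hi).symm).symm
    rw [rangeProd, this.mul_pow, ih fun i hi => h i (by omega), h n (by omega), one_mul]

lemma rangeProd_eq_altProd {f : ℕ → G} (hf : ∀ i, f (i + 2) = f i) (n : ℕ) :
    rangeProd f n = altProd (f 0) (f 1) n := by
  induction n generalizing f with
  | zero => rfl
  | succ n ih =>
    rw [rangeProd_succ_left, ih (f := fun i => f (i + 1)) fun i => hf (i + 1), altProd,
      show f (1 + 1) = f 0 from hf 0]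

/-- A product of triples `l t * d t * r t` in which every `l` commutes with the later `d`, `r` and
every `d` with the later `r` can be sorted into its three constituents. -/
lemma rangeProd_mul_mul {l d r : ℕ → G} {n : ℕ}
    (hld : ∀ t s, t ≤ s → s < n → Commute (l t) (d s))
    (hlr : ∀ t s, t ≤ s → s < n → Commute (l t) (r s))
    (hdr : ∀ t s, t ≤ s → s < n → Commute (d t) (r s)) :
    rangeProd (fun t => l t * d t * r t) n = rangeProd r n * rangeProd d n * rangeProd l n := by
  induction n with
  | zero => simp [rangeProd]
  | succ n ih =>
    have h1 : Commute (d n) (rangeProd l (n + 1)) :=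
      commute_rangeProd fun i hi => (hld i n (by omega) (by omega)).symm
    have h2 : Commute (r n) (rangeProd l (n + 1)) :=
      commute_rangeProd fun i hi => (hlr i n (by omega) (by omega)).symm
    have h3 : Commute (r n) (rangeProd d (n + 1)) :=
      commute_rangeProd fun i hi => (hdr i n (by omega) (by omega)).symm
    rw [rangeProd, ih (fun t s h hs => hld t s h (by omega)) (fun t s h hs => hlr t s h (by omega))
      (fun t s h hs => hdr t s h (by omega))]
    calc rangeProd r n * rangeProd d n * rangeProd l n * (l n * d n * r n)
        = rangeProd r n * rangeProd d n * (rangeProd l (n + 1) * d n) * r n := by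
          simp only [rangeProd, mul_assoc]
      _ = rangeProd r n * rangeProd d (n + 1) * (rangeProd l (n + 1) * r n) := by
          rw [← h1.eq]; simp only [rangeProd, mul_assoc]
      _ = rangeProd r n * (rangeProd d (n + 1) * r n) * rangeProd l (n + 1) := by
          rw [← h2.eq]; simp only [mul_assoc]
      _ = _ := by rw [← h3.eq]; simp only [rangeProd, mul_assoc]

/-- The ordered product of the `s i` with `i < n` and `i ≡ p` modulo `2`. -/
def layer (s : ℕ → G) (p n : ℕ) : G :=
  rangeProd (fun i => if (i + p) % 2 = 0 then s i else 1) n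

lemma layer_add_two (s : ℕ → G) (p n : ℕ) : layer s (p + 2) n = layer s p n :=
  rangeProd_congr fun i _ => by
    rw [show (i + (p + 2)) % 2 = (i + p) % 2 by omega]

lemma layer_add (s : ℕ → G) (p a b : ℕ) :
    layer s p (a + b) = layer s p a * layer (fun i => s (a + i)) (a + p) b := by
  rw [layer, rangeProd_add]
  congr 1
  exact rangeProd_congr fun i _ => by rw [show a + i + p = i + (a + p) by omega]

lemma layer_succ_of_odd (s : ℕ → G) {p n : ℕ} (h : (n + p) % 2 = 1) :
    layer s p (n + 1) = layer s p n := by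
  simp [layer, rangeProd, h]

lemma layer_succ_of_even (s : ℕ → G) {p n : ℕ} (h : (n + p) % 2 = 0) :
    layer s p (n + 1) = layer s p n * s n := by
  simp [layer, rangeProd, h]

lemma layer_congr_mod (s : ℕ → G) {p q : ℕ} (n : ℕ) (h : p % 2 = q % 2) :
    layer s p n = layer s q n :=
  rangeProd_congr fun i _ => by rw [show (i + p) % 2 = (i + q) % 2 by omega]

lemma layer_succ_left_of_odd (s : ℕ → G) {p : ℕ} (n : ℕ) (h : p % 2 = 1) :
    layer s p (n + 1) = layer (fun i => s (i + 1)) (p + 1) n := by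
  rw [layer, rangeProd_succ_left]
  simp only [zero_add, h, one_ne_zero, if_false, one_mul]
  exact rangeProd_congr fun i _ => by rw [show i + 1 + p = i + (p + 1) by omega]

lemma commute_layer {x : G} {s : ℕ → G} {p n : ℕ}
    (h : ∀ i < n, (i + p) % 2 = 0 → Commute x (s i)) : Commute x (layer s p n) :=
  commute_rangeProd fun i hi => by
    split_ifs with hp
    · exact h i hi hp
    · exact Commute.one_right x

lemma semiconj_layer {x : G} {s u : ℕ → G} {p n : ℕ}
    (h : ∀ i < n, SemiconjBy x (s i) (u i)) : SemiconjBy x (layer s p n) (layer u p n) :=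
  rangeProd_semiconj fun i hi => by
    split_ifs
    · exact h i hi
    · exact SemiconjBy.one_right x

lemma layer_zero_two_mul (s : ℕ → G) (h : ℕ) :
    layer s 0 (2 * h) = rangeProd (fun i => s (2 * i)) h := by
  induction h with
  | zero => rfl
  | succ h ih =>
    rw [show 2 * (h + 1) = 2 * h + 1 + 1 by ring, layer_succ_of_odd _ (by omega),
      layer_succ_of_even _ (by omega), ih, rangeProd]

lemma layer_one_two_mul (s : ℕ → G) (h : ℕ) :
    layer s 1 (2 * h) = rangeProd (fun i => s (2 * i + 1)) h := by
  induction h with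
  | zero => rfl
  | succ h ih =>
    rw [show 2 * (h + 1) = 2 * h + 1 + 1 by ring, layer_succ_of_even _ (by omega),
      layer_succ_of_odd _ (by omega), ih, rangeProd]

end RangeProd

section BraidSequence

variable {G : Type*} [Monoid G] {s : ℕ → G}

lemma semiconj_rangeProd_of_braid (hc : ∀ i j, i + 2 ≤ j → Commute (s i) (s j)) {n i : ℕ}
    (hb : ∀ i, i + 1 < n → s i * s (i + 1) * s i = s (i + 1) * s i * s (i + 1)) (hi : i + 1 < n) :
    SemiconjBy (rangeProd s n) (s i) (s (i + 1)) := by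
  obtain ⟨b, rfl⟩ := Nat.exists_eq_add_of_le (show i + 2 ≤ n by omega)
  rw [rangeProd_add]
  refine SemiconjBy.mul_left (y := s i) ?_ ?_
  · have h1 : Commute (s (i + 1)) (rangeProd s i) :=
      commute_rangeProd fun j hj => (hc j (i + 1) (by omega)).symm
    calc rangeProd s i * s i * s (i + 1) * s i
        = rangeProd s i * (s i * s (i + 1) * s i) := by simp only [mul_assoc]
      _ = (rangeProd s i * s (i + 1)) * s i * s (i + 1) := by
          rw [hb i hi]; simp only [mul_assoc]
      _ = s (i + 1) * (rangeProd s i * s i * s (i + 1)) := by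
          rw [← h1.eq]; simp only [mul_assoc]
  · exact (commute_rangeProd fun j _ => hc i _ (by omega)).symm

/-- Sliding the first strand of a stack of alternating layers to the front of the braid leaves
a stack of alternating layers on the other strands. -/
lemma rangeProd_layer_eq_rangeProd_mul (hc : ∀ i j, i + 2 ≤ j → Commute (s i) (s j)) (n : ℕ)
    (hb : ∀ i, i + 1 < n + 1 → s i * s (i + 1) * s i = s (i + 1) * s i * s (i + 1)) :
    rangeProd (fun t => layer s t (n + 1)) (n + 1) =
      rangeProd s (n + 1) * rangeProd (fun t => layer s (t + 1) n) n := by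
  have h1 : rangeProd (fun t => layer s t (n + 1)) (n + 1) =
      rangeProd (fun t => layer s t t * s t * layer (fun i => s (t + 1 + i)) 1 (n - t)) (n + 1) :=
    rangeProd_congr fun t ht => by
      rw [← layer_succ_of_even s (p := t) (n := t) (by omega)]
      conv_lhs => rw [show n + 1 = t + 1 + (n - t) by omega, layer_add]
      rw [layer_congr_mod _ _ (show (t + 1 + t) % 2 = 1 % 2 by omega)]
  have h2 : rangeProd (fun t => layer s (t + 1) n) n =
      rangeProd (fun t => layer s (t + 1) t * 1 * layer (fun i => s (t + i)) 1 (n - t)) n :=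
    rangeProd_congr fun t ht => by
      conv_lhs => rw [show n = t + (n - t) by omega, layer_add]
      rw [mul_one, layer_congr_mod _ _ (show (t + (t + 1)) % 2 = 1 % 2 by omega)]
  have h3 : SemiconjBy (rangeProd s (n + 1))
      (rangeProd (fun t => layer (fun i => s (t + i)) 1 (n - t)) (n + 1))
      (rangeProd (fun t => layer (fun i => s (t + 1 + i)) 1 (n - t)) (n + 1)) :=
    rangeProd_semiconj fun t ht => semiconj_layer fun i hi => by
      rw [show t + 1 + i = t + i + 1 by omega]
      exact semiconj_rangeProd_of_braid hc hb (by omega)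
  have h4 : rangeProd (fun t => layer s t t) (n + 1) =
      rangeProd (fun t => layer s (t + 1) t) n := by
    rw [rangeProd_succ_left, show layer s 0 0 = 1 from rfl, one_mul]
    exact rangeProd_congr fun t _ => layer_succ_of_odd s (by omega)
  have h5 : rangeProd (fun t => layer (fun i => s (t + i)) 1 (n - t)) (n + 1) =
      rangeProd (fun t => layer (fun i => s (t + i)) 1 (n - t)) n := by
    rw [rangeProd, Nat.sub_self, show layer (fun i => s (n + i)) 1 0 = 1 from rfl, mul_one]
  rw [h1, rangeProd_mul_mul, ← h3.eq, mul_assoc, h4, h5, h2, rangeProd_mul_mul, rangeProd_one,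
    mul_one]
  · exact fun _ _ _ _ => Commute.one_right _
  · intro t u htu _
    exact commute_layer fun i _ hi => (commute_layer fun j hj hjp => (hc j _ (by omega)).symm).symm
  · exact fun _ _ _ _ => Commute.one_left _
  · exact fun t u htu _ => (commute_layer fun j hj hjp => (hc j _ (by omega)).symm).symm
  · intro t u htu _
    exact commute_layer fun i _ hi => (commute_layer fun j hj hjp => (hc j _ (by omega)).symm).symm
  · exact fun t u htu _ => commute_layer fun i _ hi => hc t _ (by omega)

/-- The two stacks of `n + 1` alternating layers of the generators of the braid group on `n + 1`
strands agree (both are the half twist). -/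
lemma rangeProd_layer_comm (hc : ∀ i j, i + 2 ≤ j → Commute (s i) (s j)) (n : ℕ)
    (hb : ∀ i, i + 1 < n → s i * s (i + 1) * s i = s (i + 1) * s i * s (i + 1)) :
    rangeProd (fun t => layer s t n) (n + 1) = rangeProd (fun t => layer s (t + 1) n) (n + 1) := by
  induction n with
  | zero => rfl
  | succ n ih =>
    have core := rangeProd_layer_eq_rangeProd_mul hc n hb
    have h1 : SemiconjBy (rangeProd s (n + 1)) (layer s 0 n) (layer s 1 (n + 1)) := by
      rw [layer_succ_left_of_odd s n rfl, layer_add_two (fun i => s (i + 1)) 0]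
      exact semiconj_layer fun i hi => semiconj_rangeProd_of_braid hc hb (by omega)
    rw [rangeProd, core, rangeProd_succ_left (fun t => layer s (t + 1) (n + 1)),
      rangeProd_congr (g := fun t => layer s t (n + 1)) (fun t _ => layer_add_two s t (n + 1)),
      core, zero_add, ← mul_assoc, ← h1.eq, layer_succ_of_odd s (by omega), mul_assoc, mul_assoc]
    congr 1
    calc _ = rangeProd (fun t => layer s (t + 1) n) (n + 1) := rfl
      _ = _ := by rw [← ih fun i hi => hb i (by omega), rangeProd_succ_left]

lemma altProd_layer_comm (hc : ∀ i j, i + 2 ≤ j → Commute (s i) (s j)) (n : ℕ)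
    (hb : ∀ i, i + 1 < n → s i * s (i + 1) * s i = s (i + 1) * s i * s (i + 1)) :
    altProd (layer s 1 n) (layer s 0 n) (n + 1) = altProd (layer s 0 n) (layer s 1 n) (n + 1) := by
  have h := rangeProd_layer_comm hc n hb
  rw [rangeProd_eq_altProd (fun t => layer_add_two s t n),
    rangeProd_eq_altProd (fun t => layer_add_two s (t + 1) n)] at h
  rw [h, zero_add, layer_add_two s 0 n]

end BraidSequence

/-- The homomorphism from a dihedral group determined by the images of `sr 0` and `sr 1`. -/
def dihedralLift {G : Type*} [Group G] {k : ℕ} [NeZero k] (a b : G) (ha : a * a = 1)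
    (hb : b * b = 1) (h : (a * b) ^ k = 1) : DihedralGroup k →* G :=
  have hadd (i j : ZMod k) : (a * b) ^ (i + j).val = (a * b) ^ i.val * (a * b) ^ j.val := by
    rw [ZMod.val_add, ← pow_eq_pow_mod _ h, pow_add]
  have hneg (n : ℕ) : (a * b) ^ n * a = a * ((a * b) ^ n)⁻¹ := by
    have ha' : a⁻¹ = a := inv_eq_of_mul_eq_one_right ha
    have hb' : b⁻¹ = b := inv_eq_of_mul_eq_one_right hb
    have : SemiconjBy a (a * b)⁻¹ (a * b) := by
      rw [SemiconjBy, mul_inv_rev, ha', hb', mul_assoc]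
    rw [← inv_pow]
    exact (this.pow_right n).eq.symm
  have hsub (i j : ZMod k) : (a * b) ^ (j - i).val = ((a * b) ^ i.val)⁻¹ * (a * b) ^ j.val := by
    rw [eq_inv_mul_iff_mul_eq, ← hadd, add_sub_cancel]
  MonoidHom.mk' (fun
    | .r i => (a * b) ^ i.val
    | .sr i => a * (a * b) ^ i.val) <| by
    rintro (i | i) (j | j)
    · rw [DihedralGroup.r_mul_r]
      exact hadd i j
    · rw [DihedralGroup.r_mul_sr]
      dsimp only
      rw [hsub, ← mul_assoc, ← mul_assoc, hneg]
    · rw [DihedralGroup.sr_mul_r]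
      dsimp only
      rw [hadd, mul_assoc]
    · rw [DihedralGroup.sr_mul_sr]
      dsimp only
      rw [hsub, mul_assoc a, ← mul_assoc _ a, hneg, mul_assoc a, ← mul_assoc a, ha, one_mul]

/-- For odd `k ≥ 3` a homomorphism from the dihedral group is injective as soon as it is injective
on rotations. -/
lemma dihedral_injective_of_r {G : Type*} [Group G] {k : ℕ} (hk : 3 ≤ k) (hkodd : k % 2 = 1) (e : DihedralGroup k →* G)
    (he : ∀ i, e (.r i) = 1 → i = 0) : Function.Injective e := by
  rw [injective_iff_map_eq_one]
  rintro (i | i) hi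
  · rw [he i hi, DihedralGroup.r_zero]
  · have h1 : e (.sr i * (.r 1 * .sr i * (.r 1)⁻¹)) = 1 := by
      rw [map_mul, map_mul, map_mul, hi, map_inv]
      simp
    rw [DihedralGroup.inv_r, DihedralGroup.r_mul_sr, DihedralGroup.sr_mul_r,
      DihedralGroup.sr_mul_sr] at h1
    have h2 := he _ h1
    have h3 : ((2 : ℕ) : ZMod k) = 0 := by
      push_cast
      linear_combination -h2
    rw [ZMod.natCast_eq_zero_iff] at h3
    exact absurd (Nat.le_of_dvd two_pos h3) (by omega)

section DihedralLift

variable {G : Type*} [Group G] {k : ℕ} [NeZero k] {a b : G} (ha : a * a = 1)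
    (hb : b * b = 1) (h : (a * b) ^ k = 1)

lemma dihedralLift_r (i : ZMod k) :
    dihedralLift a b ha hb h (.r i) = (a * b) ^ i.val := rfl

lemma dihedralLift_sr_zero : dihedralLift a b ha hb h (.sr 0) = a := by
  change a * (a * b) ^ (0 : ZMod k).val = a
  simp

lemma dihedralLift_sr_one : dihedralLift a b ha hb h (.sr 1) = b := by
  change a * (a * b) ^ (1 : ZMod k).val = b
  rw [ZMod.val_one_eq_one_mod, ← pow_eq_pow_mod _ h, pow_one, ← mul_assoc, ha, one_mul]

lemma dihedralLift_injective (hk : 3 ≤ k) (hkodd : k % 2 = 1)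
    (hne : ∀ n, 0 < n → 2 * n < k → (a * b) ^ n ≠ 1) :
    Function.Injective (dihedralLift a b ha hb h) := by
  have hord : orderOf (a * b) = k := by
    have hdvd := orderOf_dvd_of_pow_eq_one h
    obtain ⟨c, hc⟩ := hdvd
    have hpos : 0 < orderOf (a * b) := Nat.pos_of_ne_zero fun h0 => by simp [h0] at hc; omega
    by_contra hlt
    refine hne _ hpos ?_ (pow_orderOf_eq_one _)
    rcases c with _ | _ | _ | c
    · omega
    · omega
    · omega
    · rw [hc]
      nlinarith
  refine dihedral_injective_of_r hk hkodd _ fun i hi => ?_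
  rw [dihedralLift_r] at hi
  have := orderOf_dvd_of_pow_eq_one hi
  rw [hord] at this
  exact (ZMod.val_eq_zero i).mp (Nat.eq_zero_of_dvd_of_lt this (ZMod.val_lt i))

end DihedralLift

lemma pow_odd_eq_one_of_altProd_comm {G : Type*} [Group G] {a b : G} (ha : a * a = 1)
    (hb : b * b = 1) {k : ℕ} (hk : k % 2 = 1) (h : altProd a b k = altProd b a k) :
    (a * b) ^ k = 1 := by
  obtain ⟨m, rfl⟩ : ∃ m, k = 2 * m + 1 := ⟨k / 2, by omega⟩
  have ha' : a⁻¹ = a := inv_eq_of_mul_eq_one_right ha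
  have hb' : b⁻¹ = b := inv_eq_of_mul_eq_one_right hb
  rw [altProd_two_mul_add_one, altProd_two_mul_add_one, ← mul_inv_eq_one, mul_inv_rev, ← inv_pow,
    mul_inv_rev, ha', hb'] at h
  rw [show 2 * m + 1 = m + 1 + m by ring, pow_add, pow_succ, ← h]
  simp only [mul_assoc]

lemma rangeProd_perm_apply {α : Type*} {f : ℕ → Equiv.Perm α} {n i : ℕ} {x y : α} (hi : i < n)
    (hxy : f i x = y) (hx : ∀ j < n, j ≠ i → f j x = x) (hy : ∀ j < n, j ≠ i → f j y = y) :
    rangeProd f n x = y := by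
  induction n with
  | zero => omega
  | succ n ih =>
    rw [rangeProd, Equiv.Perm.mul_apply]
    rcases eq_or_ne i n with rfl | hne
    · rw [hxy]
      clear hi ih hx hxy
      have : ∀ m ≤ i, rangeProd f m y = y := fun m hm => by
        induction m with
        | zero => rfl
        | succ m ih =>
          rw [rangeProd, Equiv.Perm.mul_apply, hy m (by omega) (by omega), ih (by omega)]
      exact this i le_rfl
    · rw [hx n (by omega) hne.symm]
      exact ih (by omega) (fun j hj => hx j (by omega)) (fun j hj => hy j (by omega))

lemma prod_map_finRange {G : Type*} [Monoid G] (f : ℕ → G) (n : ℕ) :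
    ((List.finRange n).map fun i => f i.1).prod = rangeProd f n := by
  induction n with
  | zero => rfl
  | succ n ih =>
    rw [List.finRange_succ_last, rangeProd, ← ih]
    simp [Function.comp_def]

/-- The braid generators as a sequence, continued by `1`. -/
def braidSeq (k i : ℕ) : BraidGroup k := if h : i < k - 1 then σ ⟨i, h⟩ else 1

lemma braidSeq_of_lt {k i : ℕ} (h : i < k - 1) : braidSeq k i = σ ⟨i, h⟩ := dif_pos h

lemma braidSeq_commute (k i j : ℕ) (h : i + 2 ≤ j) : Commute (braidSeq k i) (braidSeq k j) := by
  by_cases hj : j < k - 1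
  · rw [braidSeq_of_lt hj, braidSeq_of_lt (show i < k - 1 by omega)]
    have := PresentedGroup.one_of_mem (rels := braidRels k)
      (Or.inl ⟨⟨i, by omega⟩, ⟨j, hj⟩, h, rfl⟩)
    simp only [map_mul, map_inv] at this
    rw [mul_inv_eq_one, mul_inv_eq_iff_eq_mul] at this
    exact this
  · rw [braidSeq, braidSeq, dif_neg hj]
    exact Commute.one_right _

lemma braidSeq_braid {k i : ℕ} (h : i + 1 < k - 1) :
    braidSeq k i * braidSeq k (i + 1) * braidSeq k i =
      braidSeq k (i + 1) * braidSeq k i * braidSeq k (i + 1) := by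
  rw [braidSeq_of_lt h, braidSeq_of_lt (show i < k - 1 by omega)]
  have := PresentedGroup.one_of_mem (rels := braidRels k)
    (Or.inr ⟨⟨i, by omega⟩, ⟨i + 1, h⟩, rfl, rfl⟩)
  rw [map_mul, map_inv, mul_inv_eq_one] at this
  simp only [map_mul] at this
  exact this

lemma braidToPerm_braidSeq {k i : ℕ} (h : i + 1 < k) :
    braidToPerm k (braidSeq k i) = Equiv.swap ⟨i, by omega⟩ ⟨i + 1, h⟩ := by
  rw [braidSeq_of_lt (by omega)]
  exact PresentedGroup.toGroup.of (braid_rels_hold k)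

lemma braidToPerm_braidSeq_apply_left {k i : ℕ} (h : i + 1 < k) :
    braidToPerm k (braidSeq k i) ⟨i, by omega⟩ = ⟨i + 1, h⟩ := by
  rw [braidToPerm_braidSeq h, Equiv.swap_apply_left]

lemma braidToPerm_braidSeq_apply_of_ne {k i j : ℕ} (h : i + 1 < k) (hj : j < k) (h1 : j ≠ i)
    (h2 : j ≠ i + 1) : braidToPerm k (braidSeq k i) ⟨j, hj⟩ = ⟨j, hj⟩ := by
  rw [braidToPerm_braidSeq h, Equiv.swap_apply_of_ne_of_ne] <;> simpa

lemma braidToPerm_layer_mul_self (k p : ℕ) :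
    braidToPerm k (layer (braidSeq k) p (k - 1)) * braidToPerm k (layer (braidSeq k) p (k - 1)) =
      1 := by
  rw [layer, map_rangeProd, ← sq]
  refine rangeProd_sq (fun i j hij => ?_) fun i hi => ?_
  · refine Commute.map ?_ (braidToPerm k)
    split_ifs
    · exact braidSeq_commute k i j (by omega)
    all_goals first | exact Commute.one_right _ | exact Commute.one_left _
  · split_ifs
    · rw [braidToPerm_braidSeq (by omega), sq, Equiv.swap_mul_self]
    · simp

/-- A layer of braid generators moves the `i`-th strand to position `i + 1` if `i` has the parity
of the layer. -/
lemma braidToPerm_layer_apply {k p i : ℕ} (hp : (i + p) % 2 = 0) (hi : i + 1 < k) :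
    braidToPerm k (layer (braidSeq k) p (k - 1)) ⟨i, by omega⟩ = ⟨i + 1, hi⟩ := by
  rw [layer, map_rangeProd]
  refine rangeProd_perm_apply (i := i) (by omega) ?_ (fun j hj hne => ?_) (fun j hj hne => ?_)
  · rw [if_pos hp, braidToPerm_braidSeq_apply_left]
  all_goals
    split_ifs with hpj
    · exact braidToPerm_braidSeq_apply_of_ne (by omega) _ (by omega) (by omega)
    · simp

lemma braidToPerm_layer_pow_apply {k : ℕ} (n : ℕ) (hn : 2 * n < k) :
    ((braidToPerm k (layer (braidSeq k) 1 (k - 1)) *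
      braidToPerm k (layer (braidSeq k) 0 (k - 1))) ^ n) ⟨0, by omega⟩ = ⟨2 * n, hn⟩ := by
  induction n with
  | zero => rfl
  | succ n ih =>
    rw [pow_succ', Equiv.Perm.mul_apply, ih (by omega), Equiv.Perm.mul_apply,
      braidToPerm_layer_apply (i := 2 * n) (by omega) (by omega),
      braidToPerm_layer_apply (i := 2 * n + 1) (by omega) (by omega)]
    rfl

lemma altProd_layer_braidSeq {k : ℕ} (hk : 1 ≤ k) :
    altProd (layer (braidSeq k) 1 (k - 1)) (layer (braidSeq k) 0 (k - 1)) k =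
      altProd (layer (braidSeq k) 0 (k - 1)) (layer (braidSeq k) 1 (k - 1)) k := by
  have := altProd_layer_comm (braidSeq_commute k) (k - 1) fun i hi => braidSeq_braid hi
  rwa [Nat.sub_add_cancel hk] at this

/-- The homomorphism from the Artin group of type `I₂(k)` determined by two elements satisfying
its defining relation. -/
def artinI2Lift {G : Type*} [Group G] {k : ℕ} (a b : G) (h : altProd a b k = altProd b a k) :
    ArtinI2 k →* G :=
  PresentedGroup.toGroup (f := ![a, b]) <| by
    intro r hr
    obtain rfl := Set.mem_singleton_iff.mp hr
    rw [map_mul, map_inv, mul_inv_eq_one, map_altProd, map_altProd, FreeGroup.lift_apply_of,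
      FreeGroup.lift_apply_of]
    exact h

lemma artinI2Lift_s₁ {G : Type*} [Group G] {k : ℕ} {a b : G}
    (h : altProd a b k = altProd b a k) : artinI2Lift a b h I2s₁ = a :=
  PresentedGroup.toGroup.of _

lemma artinI2Lift_s₂ {G : Type*} [Group G] {k : ℕ} {a b : G}
    (h : altProd a b k = altProd b a k) : artinI2Lift a b h I2s₂ = b :=
  PresentedGroup.toGroup.of _

/-- Let `k ≥ 3` be odd. There exist a homomorphism `f` from the Artin
group of type `I₂(k)` to the braid group on `k` strands with `f s₁ = σ₂ σ₄ ⋯ σ_{k-1}`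
and `f s₂ = σ₁ σ₃ ⋯ σ_{k-2}`, and an injective homomorphism `e` from the dihedral group
of order `2k` into `S_k` with `e s₁ = (2 3)(4 5)⋯(k-1, k)` and
`e s₂ = (1 2)(3 4)⋯(k-2, k-1)` (permutations written here `0`-indexed on `Fin k`),
such that `π_k ∘ f = e ∘ π_S`. -/
theorem I2_odd_braid_representation (k : ℕ) (hk : 3 ≤ k) (hkodd : k % 2 = 1) :
    ∃ (f : ArtinI2 k →* BraidGroup k)
      (e : DihedralGroup k →* Equiv.Perm (Fin k)),
      f I2s₁ = ((List.finRange ((k - 1) / 2)).map fun i =>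
          σ (m := k) ⟨2 * i.1 + 1, by have := i.isLt; omega⟩).prod ∧
      f I2s₂ = ((List.finRange ((k - 1) / 2)).map fun i =>
          σ (m := k) ⟨2 * i.1, by have := i.isLt; omega⟩).prod ∧
      Function.Injective e ∧
      e (DihedralGroup.sr 0) = ((List.finRange ((k - 1) / 2)).map fun i =>
          Equiv.swap (⟨2 * i.1 + 1, by have := i.isLt; omega⟩ : Fin k)
            ⟨2 * i.1 + 2, by have := i.isLt; omega⟩).prod ∧
      e (DihedralGroup.sr 1) = ((List.finRange ((k - 1) / 2)).map fun i =>
          Equiv.swap (⟨2 * i.1, by have := i.isLt; omega⟩ : Fin k)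
            ⟨2 * i.1 + 1, by have := i.isLt; omega⟩).prod ∧
      ∀ x : ArtinI2 k, braidToPerm k (f x) = e (artinI2ToDihedral k x) := by
  have hk1 : k - 1 = 2 * ((k - 1) / 2) := by omega
  have : NeZero k := ⟨by omega⟩
  have hrel := altProd_layer_braidSeq (show 1 ≤ k by omega)
  have hodd : layer (braidSeq k) 1 (k - 1) =
      rangeProd (fun i => braidSeq k (2 * i + 1)) ((k - 1) / 2) :=
    (congrArg (layer _ _) hk1).trans (layer_one_two_mul _ _)
  have heven : layer (braidSeq k) 0 (k - 1) =
      rangeProd (fun i => braidSeq k (2 * i)) ((k - 1) / 2) :=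
    (congrArg (layer _ _) hk1).trans (layer_zero_two_mul _ _)
  have ha := braidToPerm_layer_mul_self k 1
  have hb := braidToPerm_layer_mul_self k 0
  have hpow := pow_odd_eq_one_of_altProd_comm ha hb hkodd <| by
    rw [← map_altProd, ← map_altProd, hrel]
  refine ⟨artinI2Lift _ _ hrel, dihedralLift _ _ ha hb hpow, ?_, ?_, ?_, ?_, ?_, ?_⟩
  · rw [artinI2Lift_s₁, hodd, ← prod_map_finRange]
    congr! 3 with i
    exact braidSeq_of_lt _
  · rw [artinI2Lift_s₂, heven, ← prod_map_finRange]
    congr! 3 with i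
    exact braidSeq_of_lt _
  · refine dihedralLift_injective ha hb hpow hk hkodd fun n hn hnk h1 => ?_
    have := braidToPerm_layer_pow_apply n hnk
    rw [h1, Equiv.Perm.one_apply, Fin.mk.injEq] at this
    omega
  · rw [dihedralLift_sr_zero, hodd, map_rangeProd, ← prod_map_finRange]
    congr! 3 with i
    exact braidToPerm_braidSeq _
  · rw [dihedralLift_sr_one, heven, map_rangeProd, ← prod_map_finRange]
    congr! 3 with i
    exact braidToPerm_braidSeq _
  · refine DFunLike.congr_fun (f := (braidToPerm k).comp (artinI2Lift _ _ hrel))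
      (g := (dihedralLift _ _ ha hb hpow).comp (artinI2ToDihedral k)) (PresentedGroup.ext ?_)
    intro i
    rw [MonoidHom.comp_apply, MonoidHom.comp_apply, artinI2ToDihedral, PresentedGroup.toGroup.of]
    fin_cases i
    · exact (congrArg _ (artinI2Lift_s₁ hrel)).trans (dihedralLift_sr_zero ha hb hpow).symm
    · exact (congrArg _ (artinI2Lift_s₂ hrel)).trans (dihedralLift_sr_one ha hb hpow).symm
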